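/- Let κ > 0. There exist constants C > 0 and λ₀ > 0 such that for every λ ∈ ℝ with |λ| ≥ λ₀ the following holds. Suppose u, v, f : [0,1] → ℂ are absolutely continuous with u(0)=u(1)=v(0)=v(1)=f(0)=f(1)=0 and u', v', f' ∈ L²(0,1), with u' absolutely continuous; θ : [0,1] → ℂ is absolutely continuous with θ(0)=θ(1)=0, √a·θ' ∈ L²(0,1), and aθ' absolutely continuous on [0,1] with (aθ')' ∈ L²(0,1); g, h ∈ L²(0,1;ℂ); and the resolvent system v − iλu = f, u'' − κθ' − iλv = g, (aθ')' − κv' − iλθ = h holds a.e. on (0,1). Then ∫₀¹ (|u'|² + |v|² + |θ|²) dx ≤ C ∫₀¹ (|f'|² + |g|² + |h|²) dx. -/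

import Mathlib

open MeasureTheory Set intervalIntegral Filter Topology
open ComplexConjugate

/-- `F` is absolutely continuous on `[0, 1]` with almost everywhere derivative `F'`. -/
structure HasACDeriv (F F' : ℝ → ℂ) : Prop where
  intervalIntegrable : IntervalIntegrable F' volume 0 1
  eq_integral : ∀ x ∈ Icc (0 : ℝ) 1, F x = F 0 + ∫ s in (0 : ℝ)..x, F' s

namespace HasACDeriv

variable {F F' G G' : ℝ → ℂ}

lemma integrable (hF : HasACDeriv F F') : Integrable F' (volume.restrict (Ioc (0 : ℝ) 1)) :=
  (intervalIntegrable_iff_integrableOn_Ioc_of_le zero_le_one).1 hF.intervalIntegrable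

lemma continuousOn (hF : HasACDeriv F F') : ContinuousOn F (Icc 0 1) := by
  have h := intervalIntegral.continuousOn_primitive_interval (a := (0 : ℝ)) (b := 1)
    (μ := volume) (f := F')
    ((intervalIntegrable_iff_integrableOn_Icc_of_le zero_le_one).1 hF.intervalIntegrable |>.mono_set
      (by simp))
  rw [uIcc_of_le zero_le_one] at h
  exact (continuousOn_const.add h).congr hF.eq_integral

lemma sub_eq_integral (hF : HasACDeriv F F') {x y : ℝ} (hx : x ∈ Icc (0 : ℝ) 1)
    (hy : y ∈ Icc (0 : ℝ) 1) : F y - F x = ∫ s in x..y, F' s := by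
  have hsub : ∀ z ∈ Icc (0 : ℝ) 1, IntervalIntegrable F' volume 0 z := fun z hz =>
    hF.intervalIntegrable.mono_set (by
      rw [uIcc_of_le hz.1, uIcc_of_le zero_le_one]; exact Icc_subset_Icc_right hz.2)
  rw [hF.eq_integral x hx, hF.eq_integral y hy,
    ← intervalIntegral.integral_interval_sub_left (hsub y hy) (hsub x hx)]
  ring

lemma integral_eq (hF : HasACDeriv F F') :
    ∫ x in Ioc (0 : ℝ) 1, F' x = F 1 - F 0 := by
  rw [hF.sub_eq_integral (by simp) (by simp), intervalIntegral.integral_of_le zero_le_one]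

lemma norm_sub_le (hF : HasACDeriv F F') {x y : ℝ} (hx : x ∈ Icc (0 : ℝ) 1)
    (hy : y ∈ Icc (0 : ℝ) 1) : ‖F y - F x‖ ≤ ∫ s in Ioc (0 : ℝ) 1, ‖F' s‖ := by
  rw [hF.sub_eq_integral hx hy]
  refine intervalIntegral.norm_integral_le_integral_norm_uIoc.trans ?_
  refine setIntegral_mono_set hF.integrable.norm (Eventually.of_forall fun _ => norm_nonneg _) ?_
  have hsub : uIoc x y ⊆ Ioc 0 1 := fun z hz =>
    ⟨(le_min hx.1 hy.1).trans_lt hz.1, hz.2.trans (max_le hx.2 hy.2)⟩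
  exact hsub.eventuallyLE

lemma complexConj (hF : HasACDeriv F F') :
    HasACDeriv (fun x => conj (F x)) (fun x => conj (F' x)) where
  intervalIntegrable := by
    have h := hF.integrable
    rw [intervalIntegrable_iff_integrableOn_Ioc_of_le zero_le_one]
    exact (ContinuousLinearMap.integrable_comp (Complex.conjCLE : ℂ →L[ℝ] ℂ) h)
  eq_integral x hx := by
    rw [intervalIntegral.intervalIntegral_conj, hF.eq_integral x hx, map_add]

lemma add (hF : HasACDeriv F F') (hG : HasACDeriv G G') :
    HasACDeriv (fun x => F x + G x) (fun x => F' x + G' x) where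
  intervalIntegrable := hF.intervalIntegrable.add hG.intervalIntegrable
  eq_integral x hx := by
    have hsub : uIcc 0 x ⊆ uIcc (0 : ℝ) 1 := by
      rw [uIcc_of_le hx.1, uIcc_of_le zero_le_one]; exact Icc_subset_Icc_right hx.2
    rw [intervalIntegral.integral_add (hF.intervalIntegrable.mono_set hsub)
      (hG.intervalIntegrable.mono_set hsub), hF.eq_integral x hx, hG.eq_integral x hx]
    ring

lemma const_mul (c : ℂ) (hF : HasACDeriv F F') :
    HasACDeriv (fun x => c * F x) (fun x => c * F' x) where
  intervalIntegrable := hF.intervalIntegrable.const_mul c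
  eq_integral x hx := by
    rw [intervalIntegral.integral_const_mul, hF.eq_integral x hx]
    ring

lemma ae_hasDerivAt_primitive (hF : HasACDeriv F F') (c : ℂ) :
    ∀ᵐ x, x ∈ uIcc (0 : ℝ) 1 → HasDerivAt (fun x => c + ∫ s in (0 : ℝ)..x, F' s) (F' x) x := by
  filter_upwards [hF.intervalIntegrable.ae_hasDerivAt_integral] with x hx hx'
  exact (hx hx' 0 (by simp)).const_add c

end HasACDeriv

lemma AbsolutelyContinuousOnInterval.const {F : Type*} [PseudoMetricSpace F] (c : F) (x y : ℝ) :
    AbsolutelyContinuousOnInterval (fun _ => c) x y := by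
  simpa [AbsolutelyContinuousOnInterval] using tendsto_const_nhds

lemma IntervalIntegrable.absolutelyContinuousOnInterval_integral_complex {f : ℝ → ℂ}
    (hf : IntervalIntegrable f volume 0 1) :
    AbsolutelyContinuousOnInterval (fun x => ∫ s in (0 : ℝ)..x, f s) 0 1 := by
  have hre : IntervalIntegrable (fun x => (f x).re) volume 0 1 := ⟨hf.1.re, hf.2.re⟩
  have him : IntervalIntegrable (fun x => (f x).im) volume 0 1 := ⟨hf.1.im, hf.2.im⟩
  have h1 := hre.absolutelyContinuousOnInterval_intervalIntegral (c := 0) (by simp)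
  have h2 := him.absolutelyContinuousOnInterval_intervalIntegral (c := 0) (by simp)
  have h3 := (h1.smul (.const (1 : ℂ) 0 1)).add (h2.smul (.const Complex.I 0 1))
  rw [absolutelyContinuousOnInterval_iff] at h3 ⊢
  intro ε hε
  obtain ⟨δ, hδ, H⟩ := h3 ε hε
  refine ⟨δ, hδ, fun E hE hE' => ?_⟩
  convert H E hE hE' using 1
  refine Finset.sum_congr rfl fun i hi => ?_
  have key : ∀ z ∈ uIcc (0 : ℝ) 1, ∫ s in (0 : ℝ)..z, f s =
      (∫ s in (0 : ℝ)..z, (f s).re) • (1 : ℂ) + (∫ s in (0 : ℝ)..z, (f s).im) • Complex.I := by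
    intro z hz
    have hfz : IntervalIntegrable f volume 0 z := hf.mono_set (uIcc_subset_uIcc (by simp) hz)
    apply Complex.ext
    · have := intervalIntegral.intervalIntegral_re hfz (𝕜 := ℂ)
      simpa using this.symm
    · have := Complex.imCLM.intervalIntegral_comp_comm hfz
      simpa using this.symm
  have hmem := hE.1 i hi
  simp only [Pi.add_apply, Pi.smul_apply']
  rw [key _ hmem.1, key _ hmem.2]

namespace HasACDeriv

variable {F F' G G' : ℝ → ℂ}

lemma mul (hF : HasACDeriv F F') (hG : HasACDeriv G G') :
    HasACDeriv (fun x => F x * G x) (fun x => F' x * G x + F x * G' x) := by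
  have hprod : IntervalIntegrable (fun x => F' x * G x + F x * G' x) volume 0 1 := by
    have hFc : ContinuousOn F (uIcc 0 1) := by simpa using hF.continuousOn
    have hGc : ContinuousOn G (uIcc 0 1) := by simpa using hG.continuousOn
    exact (hF.intervalIntegrable.mul_continuousOn hGc).add
      (hG.intervalIntegrable.continuousOn_mul hFc)
  refine ⟨hprod, ?_⟩
  have hprim : ∀ {f : ℝ → ℂ} (c : ℂ), IntervalIntegrable f volume 0 1 →
      AbsolutelyContinuousOnInterval (fun x => c + ∫ s in (0 : ℝ)..x, f s) 0 1 := fun c hf =>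
    (AbsolutelyContinuousOnInterval.const c 0 1).add
      hf.absolutelyContinuousOnInterval_integral_complex
  have hac := ((hprim (F 0) hF.intervalIntegrable).smul (hprim (G 0) hG.intervalIntegrable)).sub
    (hprim 0 hprod)
  obtain ⟨C, hC⟩ := hac.const_of_ae_hasDerivAt_zero (by
    filter_upwards [hF.ae_hasDerivAt_primitive (F 0), hG.ae_hasDerivAt_primitive (G 0),
      hprod.ae_hasDerivAt_integral] with x h1 h2 h3 hx
    have hx' : x ∈ Icc (0 : ℝ) 1 := by simpa using hx
    have h := ((h1 hx).mul (h2 hx)).sub ((h3 hx 0 (by simp)).const_add 0)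
    rw [← hF.eq_integral x hx', ← hG.eq_integral x hx', sub_self] at h
    exact h)
  intro x hx
  have h0 := hC 0 (by simp)
  have h1 := hC x (by simpa using hx)
  simp only [Pi.sub_apply, Pi.mul_apply, smul_eq_mul, ← hF.eq_integral x hx,
    ← hG.eq_integral x hx, intervalIntegral.integral_same, add_zero, zero_add, sub_zero] at h0 h1
  rw [h0, ← h1]
  ring

lemma mul_conj (hF : HasACDeriv F F') (hG : HasACDeriv G G') :
    HasACDeriv (fun x => F x * conj (G x)) (fun x => F' x * conj (G x) + F x * conj (G' x)) :=
  hF.mul hG.complexConj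

lemma ae_eq_zero (hF : HasACDeriv F F') (h0 : ∀ x ∈ Icc (0 : ℝ) 1, F x = 0) :
    ∀ᵐ x ∂volume.restrict (Ioc (0 : ℝ) 1), F' x = 0 := by
  rw [← restrict_Ioo_eq_restrict_Ioc, ae_restrict_iff' measurableSet_Ioo]
  filter_upwards [hF.intervalIntegrable.ae_hasDerivAt_integral] with x hx hxI
  have hd := hx (by simpa using Ioo_subset_Icc_self hxI) 0 (by simp)
  have hz : (fun x => ∫ t in (0 : ℝ)..x, F' t) =ᶠ[𝓝 x] fun _ => 0 := by
    filter_upwards [Ioo_mem_nhds hxI.1 hxI.2] with y hy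
    have := hF.eq_integral y (Ioo_subset_Icc_self hy)
    rw [h0 y (Ioo_subset_Icc_self hy), h0 0 (by simp), zero_add] at this
    exact this.symm
  exact (hd.congr_of_eventuallyEq hz.symm).unique (hasDerivAt_const x 0)

lemma memLp (hF : HasACDeriv F F') : MemLp F 2 (volume.restrict (Ioc (0 : ℝ) 1)) := by
  obtain ⟨C, hC⟩ := isCompact_Icc.exists_bound_of_continuousOn hF.continuousOn
  refine MemLp.of_bound ((hF.continuousOn.mono Ioc_subset_Icc_self).aestronglyMeasurable
    measurableSet_Ioc) C ?_
  filter_upwards [ae_restrict_mem measurableSet_Ioc] with x hx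
  exact hC x (Ioc_subset_Icc_self hx)

lemma norm_le_integral_add (hF : HasACDeriv F F') {x : ℝ} (hx : x ∈ Icc (0 : ℝ) 1) :
    ‖F x‖ ≤ (∫ s in Ioc (0 : ℝ) 1, ‖F s‖) + ∫ s in Ioc (0 : ℝ) 1, ‖F' s‖ := by
  have hFi : Integrable (fun s => ‖F s‖) (volume.restrict (Ioc (0 : ℝ) 1)) :=
    (hF.memLp.integrable (by norm_num)).norm
  have hle : ∫ _s in Ioc (0 : ℝ) 1, ‖F x‖ ≤
      ∫ s in Ioc (0 : ℝ) 1, (‖F s‖ + ∫ t in Ioc (0 : ℝ) 1, ‖F' t‖) := by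
    refine integral_mono_ae (integrable_const _) (hFi.add (integrable_const _)) ?_
    filter_upwards [ae_restrict_mem measurableSet_Ioc] with s hs
    have h1 := hF.norm_sub_le (Ioc_subset_Icc_self hs) hx
    have h2 := norm_sub_norm_le (F x) (F s)
    linarith
  rw [integral_add hFi (integrable_const _)] at hle
  simpa using hle

lemma integrable_re (hF : HasACDeriv F F') :
    Integrable (fun x => (F' x).re) (volume.restrict (Ioc (0 : ℝ) 1)) :=
  hF.integrable.re

lemma integral_re_eq (hF : HasACDeriv F F') :
    ∫ x in Ioc (0 : ℝ) 1, (F' x).re = (F 1 - F 0).re := by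
  rw [← hF.integral_eq]
  exact integral_re hF.integrable

end HasACDeriv

/-- The norm of `L²(0, 1)`. -/
noncomputable def l2Norm (φ : ℝ → ℂ) : ℝ := √(∫ x in Ioc (0 : ℝ) 1, ‖φ x‖ ^ 2)

lemma l2Norm_nonneg (φ : ℝ → ℂ) : 0 ≤ l2Norm φ := Real.sqrt_nonneg _

lemma sq_l2Norm (φ : ℝ → ℂ) : l2Norm φ ^ 2 = ∫ x in Ioc (0 : ℝ) 1, ‖φ x‖ ^ 2 :=
  Real.sq_sqrt (integral_nonneg fun _ => sq_nonneg _)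

lemma integrable_norm_sq {φ : ℝ → ℂ} (hφ : MemLp φ 2 (volume.restrict (Ioc (0 : ℝ) 1))) :
    Integrable (fun x => ‖φ x‖ ^ 2) (volume.restrict (Ioc (0 : ℝ) 1)) :=
  (memLp_two_iff_integrable_sq_norm hφ.1).1 hφ

lemma integrable_norm_mul_norm {φ ψ : ℝ → ℂ} (hφ : MemLp φ 2 (volume.restrict (Ioc (0 : ℝ) 1)))
    (hψ : MemLp ψ 2 (volume.restrict (Ioc (0 : ℝ) 1))) :
    Integrable (fun x => ‖φ x‖ * ‖ψ x‖) (volume.restrict (Ioc (0 : ℝ) 1)) :=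
  hφ.norm.integrable_mul hψ.norm

lemma integral_norm_mul_norm_le {φ ψ : ℝ → ℂ}
    (hφ : MemLp φ 2 (volume.restrict (Ioc (0 : ℝ) 1)))
    (hψ : MemLp ψ 2 (volume.restrict (Ioc (0 : ℝ) 1))) {P Q : ℝ} (hP : l2Norm φ ≤ P)
    (hQ : l2Norm ψ ≤ Q) : ∫ x in Ioc (0 : ℝ) 1, ‖φ x‖ * ‖ψ x‖ ≤ P * Q := by
  have h := integral_mul_norm_le_Lp_mul_Lq (μ := volume.restrict (Ioc (0 : ℝ) 1)) (f := φ) (g := ψ)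
    Real.HolderConjugate.two_two (by simpa using hφ) (by simpa using hψ)
  simp only [Real.rpow_two, ← Real.sqrt_eq_rpow] at h
  exact h.trans (mul_le_mul hP hQ (l2Norm_nonneg ψ) ((l2Norm_nonneg φ).trans hP))

lemma integral_norm_le_l2Norm {φ : ℝ → ℂ} (hφ : MemLp φ 2 (volume.restrict (Ioc (0 : ℝ) 1))) :
    ∫ x in Ioc (0 : ℝ) 1, ‖φ x‖ ≤ l2Norm φ := by
  have h1 : l2Norm (fun _ => 1) ≤ 1 := by simp [l2Norm]
  simpa using integral_norm_mul_norm_le hφ (memLp_const 1) le_rfl h1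

lemma l2Norm_le_of_bound {φ : ℝ → ℂ} {c : ℝ} (hc : 0 ≤ c)
    (h : ∀ x ∈ Icc (0 : ℝ) 1, ‖φ x‖ ≤ c) : l2Norm φ ≤ c := by
  have hle : ∫ x in Ioc (0 : ℝ) 1, ‖φ x‖ ^ 2 ≤ c ^ 2 := by
    have := integral_mono_of_nonneg (μ := volume.restrict (Ioc (0 : ℝ) 1))
      (f := fun x => ‖φ x‖ ^ 2) (g := fun _ => c ^ 2)
      (Eventually.of_forall fun x => sq_nonneg _) (integrable_const _) (by
        filter_upwards [ae_restrict_mem measurableSet_Ioc] with x hx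
        exact pow_le_pow_left₀ (norm_nonneg _) (h x (Ioc_subset_Icc_self hx)) 2)
    simpa using this
  exact (Real.sqrt_le_sqrt hle).trans_eq (Real.sqrt_sq hc)

lemma HasACDeriv.norm_le_integral {F F' : ℝ → ℂ} (hF : HasACDeriv F F') (h0 : F 0 = 0) {x : ℝ}
    (hx : x ∈ Icc (0 : ℝ) 1) : ‖F x‖ ≤ ∫ s in Ioc (0 : ℝ) 1, ‖F' s‖ := by
  simpa [h0] using hF.norm_sub_le (x := 0) (y := x) (by simp) hx

lemma HasACDeriv.l2Norm_le {F F' : ℝ → ℂ} (hF : HasACDeriv F F') (h0 : F 0 = 0)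
    (hF' : MemLp F' 2 (volume.restrict (Ioc (0 : ℝ) 1))) : l2Norm F ≤ l2Norm F' :=
  l2Norm_le_of_bound (l2Norm_nonneg _) fun _ hx =>
    (hF.norm_le_integral h0 hx).trans (integral_norm_le_l2Norm hF')

/-- A solution of the resolvent system of the degenerate thermoelastic equations. -/
structure ResolventSolution (a : ℝ → ℝ) (κ lam : ℝ)
    (u u' u'' v v' f f' θ θ' b b' g h : ℝ → ℂ) : Prop where
  deriv_u : HasACDeriv u u'
  deriv_u' : HasACDeriv u' u''
  deriv_v : HasACDeriv v v'
  deriv_f : HasACDeriv f f'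
  deriv_θ : HasACDeriv θ θ'
  deriv_b : HasACDeriv b b'
  u_zero : u 0 = 0
  u_one : u 1 = 0
  v_zero : v 0 = 0
  v_one : v 1 = 0
  f_zero : f 0 = 0
  θ_zero : θ 0 = 0
  θ_one : θ 1 = 0
  memLp_f' : MemLp f' 2 (volume.restrict (Ioc (0 : ℝ) 1))
  memLp_g : MemLp g 2 (volume.restrict (Ioc (0 : ℝ) 1))
  memLp_h : MemLp h 2 (volume.restrict (Ioc (0 : ℝ) 1))
  memLp_flux : MemLp (fun x => (√(a x) : ℂ) * θ' x) 2 (volume.restrict (Ioc (0 : ℝ) 1))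
  b_eq : ∀ x ∈ Ioc (0 : ℝ) 1, b x = (a x : ℂ) * θ' x
  v_eq : ∀ x ∈ Icc (0 : ℝ) 1, v x = Complex.I * lam * u x + f x
  v'_eq : ∀ᵐ x ∂volume.restrict (Ioc (0 : ℝ) 1), v' x = Complex.I * lam * u' x + f' x
  u''_eq : ∀ᵐ x ∂volume.restrict (Ioc (0 : ℝ) 1),
    u'' x = κ * θ' x + Complex.I * lam * v x + g x
  b'_eq : ∀ᵐ x ∂volume.restrict (Ioc (0 : ℝ) 1),
    b' x = κ * v' x + Complex.I * lam * θ x + h x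

lemma Complex.re_mul_conj_le (z w : ℂ) : |(z * conj w).re| ≤ ‖z‖ * ‖w‖ := by
  simpa using Complex.abs_re_le_norm (z * conj w)

namespace ResolventSolution

variable {a : ℝ → ℝ} {κ lam : ℝ} {u u' u'' v v' f f' θ θ' b b' g h : ℝ → ℂ}

lemma sq_norm_flux (hapos : ∀ x ∈ Ioc (0 : ℝ) 1, 0 < a x) {x : ℝ} (hx : x ∈ Ioc (0 : ℝ) 1)
    (z : ℂ) : ‖(√(a x) : ℂ) * z‖ ^ 2 = a x * ‖z‖ ^ 2 := by
  rw [norm_mul, mul_pow, Complex.norm_real, Real.norm_of_nonneg (Real.sqrt_nonneg _),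
    Real.sq_sqrt (hapos x hx).le]

lemma dissipation_le (S : ResolventSolution a κ lam u u' u'' v v' f f' θ θ' b b' g h)
    (hapos : ∀ x ∈ Ioc (0 : ℝ) 1, 0 < a x) {E F : ℝ} (hu : l2Norm u' ≤ E) (hv : l2Norm v ≤ E)
    (hθ : l2Norm θ ≤ E) (hf : l2Norm f' ≤ F) (hg : l2Norm g ≤ F) (hh : l2Norm h ≤ F) :
    l2Norm (fun x => (√(a x) : ℂ) * θ' x) ^ 2 ≤ 3 * (E * F) := by
  have hW := ((S.deriv_u'.mul_conj S.deriv_v).add (S.deriv_b.mul_conj S.deriv_θ)).add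
    ((S.deriv_θ.mul_conj S.deriv_v).const_mul (-κ))
  have hI := hW.integral_re_eq
  have hWi := hW.integrable_re
  simp only [S.v_zero, S.v_one, S.θ_zero, S.θ_one, map_zero, mul_zero, add_zero, sub_zero,
    Complex.zero_re] at hI
  have hfx := integrable_norm_sq S.memLp_flux
  have i1 := integrable_norm_mul_norm S.deriv_v.memLp S.memLp_g
  have i2 := integrable_norm_mul_norm S.deriv_u'.memLp S.memLp_f'
  have i3 := integrable_norm_mul_norm S.deriv_θ.memLp S.memLp_h
  have c1 := integral_norm_mul_norm_le S.deriv_v.memLp S.memLp_g hv hg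
  have c2 := integral_norm_mul_norm_le S.deriv_u'.memLp S.memLp_f' hu hf
  have c3 := integral_norm_mul_norm_le S.deriv_θ.memLp S.memLp_h hθ hh
  have hle := integral_mono_ae (hfx.sub hWi) ((i1.add i2).add i3) (by
    filter_upwards [ae_restrict_mem measurableSet_Ioc, S.v'_eq, S.u''_eq, S.b'_eq]
      with x hx e1 e2 e3
    have key : ‖(√(a x) : ℂ) * θ' x‖ ^ 2 -
        (u'' x * conj (v x) + u' x * conj (v' x) + (b' x * conj (θ x) + b x * conj (θ' x)) +
          -(κ : ℂ) * (θ' x * conj (v x) + θ x * conj (v' x))).re =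
        -((v x * conj (g x)).re + (u' x * conj (f' x)).re + (θ x * conj (h x)).re) := by
      rw [sq_norm_flux hapos hx, ← Complex.normSq_eq_norm_sq, Complex.normSq_apply, e3, e2,
        S.b_eq x hx, e1]
      simp
      ring
    have b1 := abs_le.1 (Complex.re_mul_conj_le (v x) (g x))
    have b2 := abs_le.1 (Complex.re_mul_conj_le (u' x) (f' x))
    have b3 := abs_le.1 (Complex.re_mul_conj_le (θ x) (h x))
    simp only [Pi.sub_apply, Pi.add_apply]
    linarith)
  rw [integral_sub' hfx hWi, integral_add' (i1.add i2) i3, integral_add' i1 i2, ← sq_l2Norm] at hle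
  linarith

lemma l1_norm_deriv_θ_le (S : ResolventSolution a κ lam u u' u'' v v' f f' θ θ' b b' g h)
    (hapos : ∀ x ∈ Ioc (0 : ℝ) 1, 0 < a x)
    (hainv : IntegrableOn (fun x => (a x)⁻¹) (Ioc (0 : ℝ) 1) volume) :
    ∫ x in Ioc (0 : ℝ) 1, ‖θ' x‖ ≤
      √(∫ x in Ioc (0 : ℝ) 1, (a x)⁻¹) * l2Norm (fun x => (√(a x) : ℂ) * θ' x) := by
  have hsq : ∀ x ∈ Ioc (0 : ℝ) 1, ‖((√(a x)⁻¹ : ℝ) : ℂ)‖ ^ 2 = (a x)⁻¹ := fun x hx => by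
    rw [Complex.norm_real, Real.norm_of_nonneg (Real.sqrt_nonneg _),
      Real.sq_sqrt (inv_pos.2 (hapos x hx)).le]
  have hm : MemLp (fun x => ((√(a x)⁻¹ : ℝ) : ℂ)) 2 (volume.restrict (Ioc (0 : ℝ) 1)) := by
    have hmeas : AEStronglyMeasurable (fun x => ((√(a x)⁻¹ : ℝ) : ℂ))
        (volume.restrict (Ioc (0 : ℝ) 1)) :=
      (Complex.continuous_ofReal.comp Real.continuous_sqrt).comp_aestronglyMeasurable
        hainv.aestronglyMeasurable
    rw [memLp_two_iff_integrable_sq_norm hmeas]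
    refine hainv.congr ?_
    filter_upwards [ae_restrict_mem measurableSet_Ioc] with x hx
    exact (hsq x hx).symm
  have hn : l2Norm (fun x => ((√(a x)⁻¹ : ℝ) : ℂ)) = √(∫ x in Ioc (0 : ℝ) 1, (a x)⁻¹) := by
    rw [l2Norm, setIntegral_congr_fun measurableSet_Ioc hsq]
  refine le_trans (le_of_eq ?_) (integral_norm_mul_norm_le hm S.memLp_flux hn.le le_rfl)
  refine setIntegral_congr_fun measurableSet_Ioc fun x hx => ?_
  have hpos := Real.sqrt_pos.2 (hapos x hx)
  simp only [norm_mul, Complex.norm_real, Real.sqrt_inv, norm_inv,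
    Real.norm_of_nonneg hpos.le]
  field_simp

lemma sq_l2Norm_v_le (S : ResolventSolution a κ lam u u' u'' v v' f f' θ θ' b b' g h)
    (hκ : 0 < κ) {E F T : ℝ} (hu : l2Norm u' ≤ E) (hv : l2Norm v ≤ E)
    (hθ : l2Norm θ ≤ T) (hf : l2Norm f' ≤ F) (hg : l2Norm g ≤ F) :
    l2Norm v ^ 2 ≤ l2Norm u' ^ 2 + κ * (T * E) + 2 * (E * F) := by
  have hW := (S.deriv_u'.mul_conj S.deriv_u).add
    ((S.deriv_θ.mul_conj S.deriv_u).const_mul (-κ))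
  have hI := hW.integral_re_eq
  have hWi := hW.integrable_re
  simp only [S.u_zero, S.u_one, map_zero, mul_zero, add_zero, sub_zero,
    Complex.zero_re] at hI
  have j1 := integrable_norm_sq S.deriv_v.memLp
  have j2 := integrable_norm_sq S.deriv_u'.memLp
  have i1 := (integrable_norm_mul_norm S.deriv_θ.memLp S.deriv_u'.memLp).const_mul κ
  have i2 := integrable_norm_mul_norm S.deriv_v.memLp S.deriv_f.memLp
  have i3 := integrable_norm_mul_norm S.deriv_u.memLp S.memLp_g
  have c1 := mul_le_mul_of_nonneg_left
    (integral_norm_mul_norm_le S.deriv_θ.memLp S.deriv_u'.memLp hθ hu) hκ.le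
  have c2 := integral_norm_mul_norm_le S.deriv_v.memLp S.deriv_f.memLp hv
    ((S.deriv_f.l2Norm_le S.f_zero S.memLp_f').trans hf)
  have c3 := integral_norm_mul_norm_le S.deriv_u.memLp S.memLp_g
    ((S.deriv_u.l2Norm_le S.u_zero S.deriv_u'.memLp).trans hu) hg
  have hle := integral_mono_ae ((j1.sub j2).add hWi) ((i1.add i2).add i3) (by
    filter_upwards [ae_restrict_mem measurableSet_Ioc, S.u''_eq] with x hx e2
    have key : ‖v x‖ ^ 2 - ‖u' x‖ ^ 2 +
        (u'' x * conj (u x) + u' x * conj (u' x) +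
          -(κ : ℂ) * (θ' x * conj (u x) + θ x * conj (u' x))).re =
        -(κ * (θ x * conj (u' x)).re) + (v x * conj (f x)).re + (u x * conj (g x)).re := by
      have e0 : f x = v x - Complex.I * lam * u x := by
        rw [S.v_eq x (Ioc_subset_Icc_self hx)]; ring
      rw [← Complex.normSq_eq_norm_sq, Complex.normSq_apply, ← Complex.normSq_eq_norm_sq,
        Complex.normSq_apply, e2, e0]
      simp
      ring
    have b1 := abs_le.1 (Complex.re_mul_conj_le (θ x) (u' x))
    have b2 := abs_le.1 (Complex.re_mul_conj_le (v x) (f x))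
    have b3 := abs_le.1 (Complex.re_mul_conj_le (u x) (g x))
    have b1' := mul_le_mul_of_nonneg_left b1.1 hκ.le
    simp only [Pi.sub_apply, Pi.add_apply]
    linarith)
  rw [integral_add' (j1.sub j2) hWi, integral_sub' j1 j2, integral_add' (i1.add i2) i3,
    integral_add' i1 i2, ← sq_l2Norm, ← sq_l2Norm, MeasureTheory.integral_const_mul] at hle
  linarith

lemma sq_norm_u'_le (S : ResolventSolution a κ lam u u' u'' v v' f f' θ θ' b b' g h)
    (hκ : 0 < κ) {E F N : ℝ} (hu : l2Norm u' ≤ E) (hv : l2Norm v ≤ E)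
    (hf : l2Norm f' ≤ F) (hg : l2Norm g ≤ F) (hN : ∀ x ∈ Icc (0 : ℝ) 1, ‖u' x‖ ≤ N)
    {x : ℝ} (hx : x ∈ Icc (0 : ℝ) 1) :
    ‖u' x‖ ^ 2 ≤ l2Norm u' ^ 2 + l2Norm v ^ 2 +
      (2 * κ * N * (∫ s in Ioc (0 : ℝ) 1, ‖θ' s‖) + 4 * (E * F)) := by
  have hW := (S.deriv_u'.mul_conj S.deriv_u').add (S.deriv_v.mul_conj S.deriv_v)
  have hnorm : ∀ z w : ℂ, ‖z * conj z + w * conj w‖ = ‖z‖ ^ 2 + ‖w‖ ^ 2 := fun z w => by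
    rw [Complex.mul_conj, Complex.mul_conj, ← Complex.ofReal_add, Complex.norm_real,
      Complex.normSq_eq_norm_sq, Complex.normSq_eq_norm_sq, Real.norm_of_nonneg (by positivity)]
  have hsup := hW.norm_le_integral_add hx
  simp only [hnorm] at hsup
  rw [integral_add (integrable_norm_sq S.deriv_u'.memLp) (integrable_norm_sq S.deriv_v.memLp),
    ← sq_l2Norm, ← sq_l2Norm] at hsup
  have i1 := S.deriv_θ.integrable.norm.const_mul (2 * κ * N)
  have i2 := (integrable_norm_mul_norm S.deriv_u'.memLp S.memLp_g).const_mul 2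
  have i3 := (integrable_norm_mul_norm S.deriv_v.memLp S.memLp_f').const_mul 2
  have c2 := integral_norm_mul_norm_le S.deriv_u'.memLp S.memLp_g hu hg
  have c3 := integral_norm_mul_norm_le S.deriv_v.memLp S.memLp_f' hv hf
  have hle := integral_mono_ae hW.integrable.norm ((i1.add i2).add i3) (by
    filter_upwards [ae_restrict_mem measurableSet_Ioc, S.v'_eq, S.u''_eq] with x hx e1 e2
    have key : u'' x * conj (u' x) + u' x * conj (u'' x) +
        (v' x * conj (v x) + v x * conj (v' x)) =
        κ * (θ' x * conj (u' x)) + κ * (u' x * conj (θ' x)) +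
          (g x * conj (u' x) + u' x * conj (g x)) + (f' x * conj (v x) + v x * conj (f' x)) := by
      rw [e2, e1]
      simp only [map_add, map_mul, Complex.conj_I, Complex.conj_ofReal]
      ring
    have hn : ∀ z w : ℂ, ‖z * conj w‖ = ‖z‖ * ‖w‖ := fun z w => by simp
    have hk : ‖(κ : ℂ)‖ = κ := by rw [Complex.norm_real, Real.norm_of_nonneg hκ.le]
    have hb := mul_le_mul_of_nonneg_left (hN x (Ioc_subset_Icc_self hx))
      (mul_nonneg hκ.le (norm_nonneg (θ' x)))
    simp only [Pi.add_apply]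
    rw [key]
    refine (norm_add_le_of_le (norm_add_le_of_le (norm_add_le_of_le
      (norm_mul_le _ _) (norm_mul_le _ _)) (norm_add_le _ _)) (norm_add_le _ _)).trans ?_
    simp only [hn, hk]
    linarith)
  rw [integral_add' (i1.add i2) i3, integral_add' i1 i2,
    MeasureTheory.integral_const_mul, MeasureTheory.integral_const_mul,
    MeasureTheory.integral_const_mul] at hle
  nlinarith [sq_nonneg ‖v x‖]

lemma sq_norm_b_le (S : ResolventSolution a κ lam u u' u'' v v' f f' θ θ' b b' g h)
    (hκ : 0 < κ) {E F B : ℝ} (hu : l2Norm u' ≤ E)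
    (hθ : l2Norm θ ≤ E) (hf : l2Norm f' ≤ F) (hh : l2Norm h ≤ F) (hB : l2Norm b ≤ B)
    {x : ℝ} (hx : x ∈ Icc (0 : ℝ) 1) :
    ‖b x‖ ^ 2 ≤ B ^ 2 + 2 * (B * (|lam| * κ * E + κ * F + |lam| * E + F)) := by
  have hW := S.deriv_b.mul_conj S.deriv_b
  have hnorm : ∀ z w : ℂ, ‖z * conj w‖ = ‖z‖ * ‖w‖ := fun z w => by simp
  have hsup := hW.norm_le_integral_add hx
  simp only [hnorm, ← pow_two] at hsup
  rw [← sq_l2Norm] at hsup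
  have hbm := S.deriv_b.memLp
  have i1 := (integrable_norm_mul_norm hbm S.deriv_u'.memLp).const_mul (2 * (|lam| * κ))
  have i2 := (integrable_norm_mul_norm hbm S.memLp_f').const_mul (2 * κ)
  have i3 := (integrable_norm_mul_norm hbm S.deriv_θ.memLp).const_mul (2 * |lam|)
  have i4 := (integrable_norm_mul_norm hbm S.memLp_h).const_mul 2
  have c1 := mul_le_mul_of_nonneg_left
    (integral_norm_mul_norm_le hbm S.deriv_u'.memLp hB hu) (by positivity : 0 ≤ 2 * (|lam| * κ))
  have c2 := mul_le_mul_of_nonneg_left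
    (integral_norm_mul_norm_le hbm S.memLp_f' hB hf) (by positivity : 0 ≤ 2 * κ)
  have c3 := mul_le_mul_of_nonneg_left
    (integral_norm_mul_norm_le hbm S.deriv_θ.memLp hB hθ) (by positivity : 0 ≤ 2 * |lam|)
  have c4 := integral_norm_mul_norm_le hbm S.memLp_h hB hh
  have hle := integral_mono_ae hW.integrable.norm (((i1.add i2).add i3).add i4) (by
    filter_upwards [S.v'_eq, S.b'_eq] with x e1 e3
    have hk : ‖(κ : ℂ)‖ = κ := by rw [Complex.norm_real, Real.norm_of_nonneg hκ.le]
    have hb' : ‖b' x‖ ≤ |lam| * κ * ‖u' x‖ + κ * ‖f' x‖ + |lam| * ‖θ x‖ + ‖h x‖ := by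
      rw [e3, e1, mul_add]
      refine (norm_add_le_of_le (norm_add_le_of_le (norm_add_le _ _) le_rfl) le_rfl).trans ?_
      simp only [norm_mul, hk, Complex.norm_I, Complex.norm_real, Real.norm_eq_abs]
      linarith
    have hb := mul_le_mul_of_nonneg_left hb' (norm_nonneg (b x))
    simp only [Pi.add_apply]
    refine (norm_add_le _ _).trans ?_
    rw [hnorm, hnorm]
    linarith)
  rw [integral_add' ((i1.add i2).add i3) i4, integral_add' (i1.add i2) i3, integral_add' i1 i2,
    MeasureTheory.integral_const_mul, MeasureTheory.integral_const_mul,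
    MeasureTheory.integral_const_mul, MeasureTheory.integral_const_mul] at hle
  have hB2 := pow_le_pow_left₀ (l2Norm_nonneg b) hB 2
  linarith

lemma l2Norm_b_le (S : ResolventSolution a κ lam u u' u'' v v' f f' θ θ' b b' g h)
    (hapos : ∀ x ∈ Ioc (0 : ℝ) 1, 0 < a x) {M : ℝ} (hM : ∀ x ∈ Icc (0 : ℝ) 1, a x ≤ M) :
    l2Norm b ≤ √M * l2Norm (fun x => (√(a x) : ℂ) * θ' x) := by
  have hM0 : 0 ≤ M := (hapos 1 (by simp)).le.trans (hM 1 (by simp))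
  have hle := integral_mono_ae (integrable_norm_sq S.deriv_b.memLp)
    ((integrable_norm_sq S.memLp_flux).const_mul M) (by
      filter_upwards [ae_restrict_mem measurableSet_Ioc] with x hx
      simp only [sq_norm_flux hapos hx]
      rw [S.b_eq x hx, norm_mul, mul_pow, Complex.norm_real,
        Real.norm_of_nonneg (hapos x hx).le, pow_two, mul_assoc]
      exact mul_le_mul_of_nonneg_right (hM x (Ioc_subset_Icc_self hx))
        (mul_nonneg (hapos x hx).le (sq_nonneg _)))
  rw [MeasureTheory.integral_const_mul] at hle
  rw [l2Norm, l2Norm, ← Real.sqrt_mul hM0]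
  exact Real.sqrt_le_sqrt hle

lemma sq_l2Norm_u'_le (S : ResolventSolution a κ lam u u' u'' v v' f f' θ θ' b b' g h)
    (hapos : ∀ x ∈ Ioc (0 : ℝ) 1, 0 < a x) (hκ : 0 < κ) {E F T B N β : ℝ}
    (hu : l2Norm u' ≤ E) (hv : l2Norm v ≤ E) (hθ : l2Norm θ ≤ T) (hf : l2Norm f' ≤ F)
    (hg : l2Norm g ≤ F) (hh : l2Norm h ≤ F) (hB : l2Norm b ≤ B)
    (hN : ∀ x ∈ Icc (0 : ℝ) 1, ‖u' x‖ ≤ N) (hβ : ∀ x ∈ Icc (0 : ℝ) 1, ‖b x‖ ≤ β) :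
    |lam| * κ * l2Norm u' ^ 2 ≤ 2 * (β * N) + κ * (F * E) + |lam| * (T * E) + F * E +
      κ * l2Norm (fun x => (√(a x) : ℂ) * θ' x) ^ 2 + |lam| * (B * E) + B * F := by
  have hW := S.deriv_b.mul_conj S.deriv_u'
  have hbm := S.deriv_b.memLp
  have hum := S.deriv_u'.memLp
  have i1 := (integrable_norm_mul_norm S.memLp_f' hum).const_mul κ
  have i2 := (integrable_norm_mul_norm S.deriv_θ.memLp hum).const_mul |lam|
  have i3 := integrable_norm_mul_norm S.memLp_h hum
  have i4 := (integrable_norm_sq S.memLp_flux).const_mul κ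
  have i5 := (integrable_norm_mul_norm hbm S.deriv_v.memLp).const_mul |lam|
  have i6 := integrable_norm_mul_norm hbm S.memLp_g
  have c1 := mul_le_mul_of_nonneg_left (integral_norm_mul_norm_le S.memLp_f' hum hf hu) hκ.le
  have c2 := mul_le_mul_of_nonneg_left (integral_norm_mul_norm_le S.deriv_θ.memLp hum hθ hu)
    (abs_nonneg lam)
  have c3 := integral_norm_mul_norm_le S.memLp_h hum hh hu
  have c5 := mul_le_mul_of_nonneg_left (integral_norm_mul_norm_le hbm S.deriv_v.memLp hB hv)
    (abs_nonneg lam)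
  have c6 := integral_norm_mul_norm_le hbm S.memLp_g hB hg
  have hbd : ∀ x ∈ Icc (0 : ℝ) 1, ‖b x * conj (u' x)‖ ≤ β * N := fun x hx => by
    rw [norm_mul, RCLike.norm_conj]
    exact mul_le_mul (hβ x hx) (hN x hx) (norm_nonneg _) ((norm_nonneg _).trans (hβ x hx))
  have hsum := (((((i1.add i2).add i3).add i4).add i5).add i6)
  have hsub : Integrable (fun x => Complex.I * lam * κ * (u' x * conj (u' x)))
      (volume.restrict (Ioc (0 : ℝ) 1)) :=
    (hum.integrable_mul hum.star).const_mul _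
  have hle := norm_integral_le_of_norm_le hsum (f := fun x =>
      (b' x * conj (u' x) + b x * conj (u'' x)) - Complex.I * lam * κ * (u' x * conj (u' x))) (by
    filter_upwards [ae_restrict_mem measurableSet_Ioc, S.v'_eq, S.u''_eq, S.b'_eq]
      with x hx e1 e2 e3
    have key : (b' x * conj (u' x) + b x * conj (u'' x)) -
        Complex.I * lam * κ * (u' x * conj (u' x)) =
        κ * (f' x * conj (u' x)) + Complex.I * lam * (θ x * conj (u' x)) + h x * conj (u' x) +
          κ * (a x * (θ' x * conj (θ' x))) + -Complex.I * lam * (b x * conj (v x)) +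
          b x * conj (g x) := by
      rw [e3, e2, e1]
      simp only [map_add, map_mul, Complex.conj_I, Complex.conj_ofReal, mul_add]
      rw [S.b_eq x hx]
      ring
    have hk : ‖(κ : ℂ)‖ = κ := by rw [Complex.norm_real, Real.norm_of_nonneg hκ.le]
    have hax : ‖(a x : ℂ)‖ = a x := by
      rw [Complex.norm_real, Real.norm_of_nonneg (hapos x hx).le]
    rw [key]
    refine (norm_add_le_of_le (norm_add_le_of_le (norm_add_le_of_le (norm_add_le_of_le
      (norm_add_le _ _) le_rfl) le_rfl) le_rfl) le_rfl).trans (le_of_eq ?_)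
    simp only [Pi.add_apply, sq_norm_flux hapos hx]
    simp only [norm_mul, norm_neg, RCLike.norm_conj, hk, hax, Complex.norm_I, Complex.norm_real,
      Real.norm_eq_abs]
    ring)
  rw [integral_sub hW.integrable hsub, hW.integral_eq, MeasureTheory.integral_const_mul,
    integral_add' ((((i1.add i2).add i3).add i4).add i5) i6,
    integral_add' (((i1.add i2).add i3).add i4) i5, integral_add' ((i1.add i2).add i3) i4,
    integral_add' (i1.add i2) i3, integral_add' i1 i2,
    MeasureTheory.integral_const_mul, MeasureTheory.integral_const_mul,
    MeasureTheory.integral_const_mul, MeasureTheory.integral_const_mul, ← sq_l2Norm] at hle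
  have hsq : ∫ x in Ioc (0 : ℝ) 1, u' x * conj (u' x) = ((l2Norm u' ^ 2 : ℝ) : ℂ) := by
    rw [sq_l2Norm, ← integral_complex_ofReal]
    simp only [Complex.mul_conj, Complex.normSq_eq_norm_sq]
  have hnorm : ‖Complex.I * lam * κ * ∫ x in Ioc (0 : ℝ) 1, u' x * conj (u' x)‖ =
      |lam| * κ * l2Norm u' ^ 2 := by
    rw [hsq]
    simp only [norm_mul, Complex.norm_I, Complex.norm_real, Real.norm_eq_abs, one_mul,
      abs_of_pos hκ, abs_of_nonneg (sq_nonneg (l2Norm u'))]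
  have t1 := norm_sub_norm_le (Complex.I * lam * κ * ∫ x in Ioc (0 : ℝ) 1, u' x * conj (u' x))
    (b 1 * conj (u' 1) - b 0 * conj (u' 0))
  rw [hnorm] at t1
  rw [norm_sub_rev] at hle
  have t2 := norm_sub_le_of_le (hbd 1 (by simp)) (hbd 0 (by simp))
  linarith

end ResolventSolution

lemma exists_bound_of_resolvent_inequalities {κ A m : ℝ} (hκ : 0 < κ) (hA : 0 ≤ A) (hm : 0 ≤ m) :
    ∃ C > 0, ∀ {l E F D N β U V W : ℝ}, 1 ≤ l → 0 ≤ E → 0 ≤ F → 0 ≤ D → 0 ≤ N → 0 ≤ β →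
      E ^ 2 = U + V + W → D ^ 2 ≤ 3 * (E * F) →
      N ^ 2 ≤ U + V + (2 * κ * N * (A * D) + 4 * (E * F)) → 0 ≤ W →
      β ^ 2 ≤ (m * D) ^ 2 + 2 * (m * D * (l * κ * E + κ * F + l * E + F)) →
      l * κ * U ≤ 2 * (β * N) + κ * (F * E) + l * (A * D * E) + F * E + κ * D ^ 2 +
        l * (m * D * E) + m * D * F →
      V ≤ U + κ * (A * D * E) + 2 * (E * F) → W ≤ (A * D) ^ 2 →
      E ^ 2 ≤ C * F ^ 2 := by
  obtain ⟨n, hn⟩ : ∃ n, n = 5 + 4 * κ * A := ⟨_, rfl⟩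
  obtain ⟨p, hp⟩ : ∃ p, p = 4 * m ^ 2 + 8 * m * (κ + 1) := ⟨_, rfl⟩
  obtain ⟨r, hr⟩ : ∃ r, r = 2 * (1 + p) * n + κ + 2 * A + 1 + 4 * κ + 4 * m := ⟨_, rfl⟩
  obtain ⟨s, hs⟩ : ∃ s, s = 2 * (r / κ) + 2 * κ * A + 2 + 4 * A ^ 2 := ⟨_, rfl⟩
  have hn0 : 0 < n := by rw [hn]; positivity
  have hp0 : 0 ≤ p := by rw [hp]; positivity
  have hr0 : 0 < r := by rw [hr]; positivity
  have hs0 : 0 < s := by rw [hs]; positivity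
  refine ⟨s ^ 8 + 1, by positivity, ?_⟩
  intro l E F D N β U V W hl hE hF hD hN hβ hEeq hDle hNle hW0 hβle hU hV hW
  rcases le_or_gt E F with hEF | hEF
  · linarith [pow_le_pow_left₀ hE hEF 2, mul_nonneg (pow_nonneg hs0.le 8) (sq_nonneg F)]
  have hE0 : 0 < E := hF.trans_lt hEF
  obtain ⟨G, hG0, hG2⟩ : ∃ G, 0 ≤ G ∧ G ^ 2 = E * F :=
    ⟨√(E * F), Real.sqrt_nonneg _, Real.sq_sqrt (by positivity)⟩
  have hGE : G ≤ E := (sq_le_sq₀ hG0 hE).1 (by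
    rw [hG2, sq]; exact mul_le_mul_of_nonneg_left hEF.le hE)
  have hFG : F ≤ G := (sq_le_sq₀ hF hG0).1 (by
    rw [hG2, sq]; exact mul_le_mul_of_nonneg_right hEF.le hF)
  obtain ⟨K, hK0, hK2⟩ : ∃ K, 0 ≤ K ∧ K ^ 2 = G * E :=
    ⟨√(G * E), Real.sqrt_nonneg _, Real.sq_sqrt (by positivity)⟩
  have hGK : G ≤ K := (sq_le_sq₀ hG0 hK0).1 (by
    rw [hK2, sq]; exact mul_le_mul_of_nonneg_left hGE hG0)
  have hFK : F ≤ K := hFG.trans hGK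
  have hDG : D ≤ 2 * G := (sq_le_sq₀ hD (by positivity)).1 (by
    rw [mul_pow, hG2]; linarith [mul_nonneg hE hF])
  have hFE : F * E ≤ K * E := by gcongr
  have hDK : D ≤ 2 * K := by linarith
  have hDE : D * E ≤ 2 * (K * E) := by
    rw [← mul_assoc]; gcongr
  have hD2 : D ^ 2 ≤ 4 * (K * E) := by linarith [mul_nonneg hE hF]
  have hDF : D * F ≤ 2 * (K * E) := by
    rw [← mul_assoc]; gcongr
  have hNE : N ≤ n * E := by
    by_contra! hlt
    have hEN : E ≤ N := by
      rw [hn] at hlt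
      linarith [mul_nonneg (mul_nonneg hκ.le hA) hE]
    have h1 : κ * A * N * D ≤ κ * A * N * (2 * E) := by gcongr; linarith
    have h2 : N * (n * E) < N * N := by
      apply mul_lt_mul_of_pos_left hlt; linarith
    have h3 : E * E ≤ N * E := by gcongr
    have h4 : E * F ≤ N * E := by rw [mul_comm]; gcongr; linarith
    rw [hn] at h2
    linarith
  have hβK : β ≤ (1 + p) * (l * K) := by
    refine (sq_le_sq₀ hβ (by positivity)).1 ?_
    have h1 : l * κ * E + κ * F + l * E + F ≤ 2 * (κ + 1) * (l * E) := by
      have h : F ≤ l * E := hEF.le.trans (le_mul_of_one_le_left hE hl)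
      linarith [mul_le_mul_of_nonneg_left h hκ.le]
    have h2 : m * D * (l * κ * E + κ * F + l * E + F) ≤
        m * (2 * G) * (2 * (κ + 1) * (l * E)) := by gcongr
    have h3 : (m * D) ^ 2 ≤ m ^ 2 * 4 * (G * E) := by
      have : D ^ 2 ≤ 4 * (G * E) := by linarith [mul_le_mul_of_nonneg_left hFG hE, mul_nonneg hE hF]
      rw [mul_pow, mul_assoc]
      gcongr
    have h4 : β ^ 2 ≤ p * l ^ 2 * K ^ 2 := by
      rw [hK2]
      have hl2 : l ≤ l ^ 2 := le_self_pow₀ hl two_ne_zero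
      have hge : 0 ≤ G * E := by positivity
      have h5 : 8 * m * (κ + 1) * (l * (G * E)) ≤ 8 * m * (κ + 1) * (l ^ 2 * (G * E)) := by gcongr
      have h6 : m ^ 2 * 4 * (1 * (G * E)) ≤ m ^ 2 * 4 * (l ^ 2 * (G * E)) := by
        gcongr; linarith
      rw [hp]
      linarith
    have h7 : p ≤ (1 + p) ^ 2 := by linarith [sq_nonneg p]
    calc β ^ 2 ≤ p * l ^ 2 * K ^ 2 := h4
      _ ≤ (1 + p) ^ 2 * l ^ 2 * K ^ 2 := by gcongr
      _ = ((1 + p) * (l * K)) ^ 2 := by ring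
  have hKE : 0 ≤ K * E := by positivity
  have hUle : κ * U ≤ r * (K * E) := by
    have h1 : β * N ≤ (1 + p) * (l * K) * (n * E) := by gcongr
    have h2 : κ * (F * E) ≤ l * (κ * (K * E)) := by
      have : κ * (F * E) ≤ κ * (K * E) := by gcongr
      exact this.trans (le_mul_of_one_le_left (by positivity) hl)
    have h3 : l * (A * D * E) ≤ l * (A * (2 * (K * E))) := by
      rw [mul_assoc A]; gcongr
    have h4 : F * E ≤ l * (K * E) := hFE.trans (le_mul_of_one_le_left hKE hl)
    have h5 : κ * D ^ 2 ≤ l * (κ * (4 * (K * E))) := by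
      have : κ * D ^ 2 ≤ κ * (4 * (K * E)) := by gcongr
      exact this.trans (le_mul_of_one_le_left (by positivity) hl)
    have h6 : l * (m * D * E) ≤ l * (m * (2 * (K * E))) := by
      rw [mul_assoc m]; gcongr
    have h7 : m * D * F ≤ l * (m * (2 * (K * E))) := by
      have : m * (D * F) ≤ m * (2 * (K * E)) := by gcongr
      rw [mul_assoc]
      exact this.trans (le_mul_of_one_le_left (by positivity) hl)
    have h8 : l * (κ * U) ≤ l * (r * (K * E)) := by
      rw [hr]
      linarith
    exact le_of_mul_le_mul_left h8 (by linarith)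
  have hUle' : U ≤ r / κ * (K * E) := by
    rw [div_mul_eq_mul_div, le_div_iff₀ hκ]; linarith
  have hEK : E ≤ s * K := by
    have h1 : κ * (A * D * E) ≤ κ * (A * (2 * (K * E))) := by
      rw [mul_assoc A]; gcongr
    have h2 : (A * D) ^ 2 ≤ A ^ 2 * (4 * (K * E)) := by rw [mul_pow]; gcongr
    have h3 : E * E ≤ s * K * E := by
      rw [hs]
      linarith
    exact le_of_mul_le_mul_right h3 hE0
  have hEG : E ≤ s ^ 2 * G := by
    have h1 : E ^ 2 ≤ (s * K) ^ 2 := by gcongr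
    rw [mul_pow, hK2] at h1
    exact le_of_mul_le_mul_right (by linarith : E * E ≤ s ^ 2 * G * E) hE0
  have hEF' : E ≤ s ^ 4 * F := by
    have h1 : E ^ 2 ≤ (s ^ 2 * G) ^ 2 := by gcongr
    rw [mul_pow, hG2] at h1
    exact le_of_mul_le_mul_right (by linarith : E * E ≤ s ^ 4 * F * E) hE0
  calc E ^ 2 ≤ (s ^ 4 * F) ^ 2 := by gcongr
    _ ≤ (s ^ 8 + 1) * F ^ 2 := by linarith [sq_nonneg F]

lemma ResolventSolution.exists_bound {a : ℝ → ℝ} (haC : ContinuousOn a (Icc (0 : ℝ) 1))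
    (hapos : ∀ x ∈ Ioc (0 : ℝ) 1, 0 < a x)
    (hainv : IntegrableOn (fun x => (a x)⁻¹) (Ioc (0 : ℝ) 1) volume) {κ : ℝ} (hκ : 0 < κ) :
    ∃ C > 0, ∀ {lam : ℝ} {u u' u'' v v' f f' θ θ' b b' g h : ℝ → ℂ}, 1 ≤ |lam| →
      ResolventSolution a κ lam u u' u'' v v' f f' θ θ' b b' g h →
      l2Norm u' ^ 2 + l2Norm v ^ 2 + l2Norm θ ^ 2 ≤
        C * (l2Norm f' ^ 2 + l2Norm g ^ 2 + l2Norm h ^ 2) := by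
  obtain ⟨M, hM⟩ := isCompact_Icc.exists_bound_of_continuousOn haC
  have hM' : ∀ x ∈ Icc (0 : ℝ) 1, a x ≤ M := fun x hx => (le_abs_self _).trans (hM x hx)
  obtain ⟨C, hC, H⟩ := exists_bound_of_resolvent_inequalities hκ
    (Real.sqrt_nonneg (∫ x in Ioc (0 : ℝ) 1, (a x)⁻¹)) (Real.sqrt_nonneg M)
  refine ⟨C, hC, ?_⟩
  intro lam u u' u'' v v' f f' θ θ' b b' g h hlam S
  have hE2 := Real.sq_sqrt (by positivity : 0 ≤ l2Norm u' ^ 2 + l2Norm v ^ 2 + l2Norm θ ^ 2)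
  have hF2 := Real.sq_sqrt (by positivity : 0 ≤ l2Norm f' ^ 2 + l2Norm g ^ 2 + l2Norm h ^ 2)
  set E := √(l2Norm u' ^ 2 + l2Norm v ^ 2 + l2Norm θ ^ 2)
  set F := √(l2Norm f' ^ 2 + l2Norm g ^ 2 + l2Norm h ^ 2)
  have hE0 : 0 ≤ E := Real.sqrt_nonneg _
  have hF0 : 0 ≤ F := Real.sqrt_nonneg _
  have hu : l2Norm u' ≤ E := Real.le_sqrt_of_sq_le (by nlinarith)
  have hv : l2Norm v ≤ E := Real.le_sqrt_of_sq_le (by nlinarith)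
  have hθ : l2Norm θ ≤ E := Real.le_sqrt_of_sq_le (by nlinarith)
  have hf : l2Norm f' ≤ F := Real.le_sqrt_of_sq_le (by nlinarith)
  have hg : l2Norm g ≤ F := Real.le_sqrt_of_sq_le (by nlinarith)
  have hh : l2Norm h ≤ F := Real.le_sqrt_of_sq_le (by nlinarith)
  have hT := S.l1_norm_deriv_θ_le hapos hainv
  have hB := S.l2Norm_b_le hapos hM'
  have hθT := l2Norm_le_of_bound (integral_nonneg fun _ => norm_nonneg _) fun _ hx =>
    S.deriv_θ.norm_le_integral S.θ_zero hx
  have hθT' := hθT.trans hT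
  obtain ⟨x₁, hx₁, hmax₁⟩ := isCompact_Icc.exists_isMaxOn (nonempty_Icc.2 zero_le_one)
    S.deriv_u'.continuousOn.norm
  obtain ⟨x₂, hx₂, hmax₂⟩ := isCompact_Icc.exists_isMaxOn (nonempty_Icc.2 zero_le_one)
    S.deriv_b.continuousOn.norm
  have hN := S.sq_norm_u'_le hκ hu hv hf hg (fun x hx => hmax₁ hx) hx₁
  rw [← hE2, ← hF2]
  refine H hlam hE0 hF0 (l2Norm_nonneg _) (norm_nonneg (u' x₁)) (norm_nonneg (b x₂)) hE2
    (S.dissipation_le hapos hu hv hθ hf hg hh) (hN.trans ?_) (sq_nonneg _)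
    (S.sq_norm_b_le hκ hu hθ hf hh hB hx₂)
    (S.sq_l2Norm_u'_le hapos hκ hu hv hθT' hf hg hh hB (fun x hx => hmax₁ hx)
      (fun x hx => hmax₂ hx))
    (S.sq_l2Norm_v_le hκ hu hv hθT' hf hg)
    (pow_le_pow_left₀ (l2Norm_nonneg _) hθT' 2)
  gcongr

/-- (Weakly degenerate case.) Uniform resolvent estimate at high
frequencies: there are `C > 0` and `λ₀ > 0` such that for `|λ| ≥ λ₀` every solution of the
resolvent system `v − iλu = f`, `u'' − κθ' − iλv = g`, `(aθ')' − κv' − iλθ = h` satisfies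
`∫₀¹(|u'|² + |v|² + |θ|²) ≤ C ∫₀¹(|f'|² + |g|² + |h|²)`. -/
theorem stmt_18 (a : ℝ → ℝ)
    (haC : ContinuousOn a (Icc (0:ℝ) 1))
    (haC1 : ContDiffOn ℝ 1 a (Ioc (0:ℝ) 1))
    (ha0 : a 0 = 0)
    (hapos : ∀ x ∈ Ioc (0:ℝ) 1, 0 < a x)
    (haL1 : IntegrableOn (fun x => (a x)⁻¹) (Ioc (0:ℝ) 1) volume)
    (κ : ℝ) (hκ : 0 < κ) :
    ∃ C > (0:ℝ), ∃ lam₀ > (0:ℝ), ∀ (lam : ℝ), lam₀ ≤ |lam| →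
      ∀ (u u' u'' v v' f f' θ θ' b b' g h : ℝ → ℂ),
      -- u, v, f absolutely continuous, vanishing at 0 and 1, with u', v', f' ∈ L²
      IntervalIntegrable u' volume 0 1 →
      (∀ x ∈ Icc (0:ℝ) 1, u x = u 0 + ∫ s in (0:ℝ)..x, u' s) →
      u 0 = 0 → u 1 = 0 →
      MemLp u' 2 (volume.restrict (Ioc (0:ℝ) 1)) →
      IntervalIntegrable v' volume 0 1 →
      (∀ x ∈ Icc (0:ℝ) 1, v x = v 0 + ∫ s in (0:ℝ)..x, v' s) →
      v 0 = 0 → v 1 = 0 →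
      MemLp v' 2 (volume.restrict (Ioc (0:ℝ) 1)) →
      IntervalIntegrable f' volume 0 1 →
      (∀ x ∈ Icc (0:ℝ) 1, f x = f 0 + ∫ s in (0:ℝ)..x, f' s) →
      f 0 = 0 → f 1 = 0 →
      MemLp f' 2 (volume.restrict (Ioc (0:ℝ) 1)) →
      -- u' absolutely continuous with a.e. derivative u''
      IntervalIntegrable u'' volume 0 1 →
      (∀ x ∈ Icc (0:ℝ) 1, u' x = u' 0 + ∫ s in (0:ℝ)..x, u'' s) →
      -- θ absolutely continuous, θ(0)=θ(1)=0, √a·θ' ∈ L²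
      IntervalIntegrable θ' volume 0 1 →
      (∀ x ∈ Icc (0:ℝ) 1, θ x = θ 0 + ∫ s in (0:ℝ)..x, θ' s) →
      θ 0 = 0 → θ 1 = 0 →
      MemLp (fun x => (Real.sqrt (a x) : ℂ) * θ' x) 2 (volume.restrict (Ioc (0:ℝ) 1)) →
      -- aθ' absolutely continuous on [0,1] with (aθ')' ∈ L²
      (∀ x ∈ Ioc (0:ℝ) 1, b x = (a x : ℂ) * θ' x) →
      IntervalIntegrable b' volume 0 1 →
      (∀ x ∈ Icc (0:ℝ) 1, b x = b 0 + ∫ s in (0:ℝ)..x, b' s) →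
      MemLp b' 2 (volume.restrict (Ioc (0:ℝ) 1)) →
      -- g, h ∈ L²
      MemLp g 2 (volume.restrict (Ioc (0:ℝ) 1)) →
      MemLp h 2 (volume.restrict (Ioc (0:ℝ) 1)) →
      -- resolvent system, a.e. on (0,1)
      (∀ᵐ x ∂volume, x ∈ Ioo (0:ℝ) 1 → v x - Complex.I * lam * u x = f x) →
      (∀ᵐ x ∂volume, x ∈ Ioo (0:ℝ) 1 →
        u'' x - (κ : ℂ) * θ' x - Complex.I * lam * v x = g x) →
      (∀ᵐ x ∂volume, x ∈ Ioo (0:ℝ) 1 →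
        b' x - (κ : ℂ) * v' x - Complex.I * lam * θ x = h x) →
      ∫ x in (0:ℝ)..1, (‖u' x‖ ^ 2 + ‖v x‖ ^ 2 + ‖θ x‖ ^ 2)
        ≤ C * ∫ x in (0:ℝ)..1, (‖f' x‖ ^ 2 + ‖g x‖ ^ 2 + ‖h x‖ ^ 2) := by
  obtain ⟨C, hC, H⟩ := ResolventSolution.exists_bound haC hapos haL1 hκ
  refine ⟨C, hC, 1, one_pos, ?_⟩
  intro lam hlam u u' u'' v v' f f' θ θ' b b' g h iu' eu u0 u1 mu' iv' ev v0 v1 mv' if' ef f0 f1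
    mf' iu'' eu' iθ' eθ θ0 θ1 mθ hb ib' eb mb' mg mh e1 e2 e3
  have hdu : HasACDeriv u u' := ⟨iu', eu⟩
  have hdv : HasACDeriv v v' := ⟨iv', ev⟩
  have hdf : HasACDeriv f f' := ⟨if', ef⟩
  have hdθ : HasACDeriv θ θ' := ⟨iθ', eθ⟩
  have hae : ∀ {p : ℝ → Prop}, (∀ᵐ x ∂volume, x ∈ Ioo (0 : ℝ) 1 → p x) →
      ∀ᵐ x ∂volume.restrict (Ioc (0 : ℝ) 1), p x := fun hp => by
    rwa [← restrict_Ioo_eq_restrict_Ioc, ae_restrict_iff' measurableSet_Ioo]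
  have hdiff := (hdv.add (hdu.const_mul (-(Complex.I * lam)))).add (hdf.const_mul (-1))
  have hzero : ∀ x ∈ Icc (0 : ℝ) 1, v x + -(Complex.I * lam) * u x + -1 * f x = 0 := by
    have hIoo : EqOn (fun x => v x + -(Complex.I * lam) * u x + -1 * f x) (fun _ => 0)
        (Ioo (0 : ℝ) 1) := by
      refine Measure.eqOn_open_of_ae_eq (μ := volume) ?_ isOpen_Ioo
        (hdiff.continuousOn.mono Ioo_subset_Icc_self) continuousOn_const
      rw [restrict_Ioo_eq_restrict_Ioc]
      filter_upwards [hae e1] with x hx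
      linear_combination hx
    intro x hx
    rcases eq_or_ne x 0 with rfl | hx0
    · simp [v0, u0, f0]
    rcases eq_or_ne x 1 with rfl | hx1
    · simp [v1, u1, f1]
    exact hIoo ⟨lt_of_le_of_ne hx.1 hx0.symm, lt_of_le_of_ne hx.2 hx1⟩
  have S : ResolventSolution a κ lam u u' u'' v v' f f' θ θ' b b' g h :=
    { deriv_u := hdu
      deriv_u' := ⟨iu'', eu'⟩
      deriv_v := hdv
      deriv_f := hdf
      deriv_θ := hdθ
      deriv_b := ⟨ib', eb⟩
      u_zero := u0
      u_one := u1
      v_zero := v0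
      v_one := v1
      f_zero := f0
      θ_zero := θ0
      θ_one := θ1
      memLp_f' := mf'
      memLp_g := mg
      memLp_h := mh
      memLp_flux := mθ
      b_eq := hb
      v_eq := fun x hx => by linear_combination hzero x hx
      v'_eq := by
        filter_upwards [hdiff.ae_eq_zero hzero] with x hx
        linear_combination hx
      u''_eq := by
        filter_upwards [hae e2] with x hx
        linear_combination hx
      b'_eq := by
        filter_upwards [hae e3] with x hx
        linear_combination hx }
  have hsum : ∀ {φ ψ χ : ℝ → ℂ}, MemLp φ 2 (volume.restrict (Ioc (0 : ℝ) 1)) →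
      MemLp ψ 2 (volume.restrict (Ioc (0 : ℝ) 1)) →
      MemLp χ 2 (volume.restrict (Ioc (0 : ℝ) 1)) →
      ∫ x in (0 : ℝ)..1, (‖φ x‖ ^ 2 + ‖ψ x‖ ^ 2 + ‖χ x‖ ^ 2) =
        l2Norm φ ^ 2 + l2Norm ψ ^ 2 + l2Norm χ ^ 2 := fun hφ hψ hχ => by
    have h1 := integrable_norm_sq hφ
    have h2 := integrable_norm_sq hψ
    have h3 := integrable_norm_sq hχ
    rw [intervalIntegral.integral_of_le zero_le_one, sq_l2Norm, sq_l2Norm, sq_l2Norm,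
      ← MeasureTheory.integral_add h1 h2]
    exact MeasureTheory.integral_add (h1.add h2) h3
  rw [hsum mu' hdv.memLp hdθ.memLp, hsum mf' mg mh]
  exact H hlam S
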